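/- Let X be a topological space, A ⊂ X be a compact set, and let f and φ be lower semicontinuous on A. Then the penalty function F_λ is (globally) exact if and only if F_λ is exact at every globally optimal solution of the problem (P). -/

import Mathlib

open Filter Topology Set

/-- The linear penalty function `F_λ = f + λ φ`. -/
noncomputable def penaltyFun {X : Type*} (f : X → EReal) (φ : X → ℝ) (lam : ℝ) : X → EReal :=
  fun x => f x + ((lam * φ x : ℝ) : EReal)

/-- The penalty function `F_λ` is (locally) exact at `x`. -/
def ExactPenaltyAt {X : Type*} [TopologicalSpace X] (f : X → EReal) (φ : X → ℝ)
    (A : Set X) (x : X) : Prop :=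
  ∃ lam : ℝ, 0 ≤ lam ∧ IsLocalMinOn (penaltyFun f φ lam) A x

/-- The penalty function `F_λ` is globally exact. -/
def GloballyExact {X : Type*} (f : X → EReal) (φ : X → ℝ) (A M : Set X) : Prop :=
  ∃ lam0 : ℝ, 0 ≤ lam0 ∧ ∀ lam : ℝ, lam0 < lam →
    {x | x ∈ A ∧ ∀ y ∈ A, penaltyFun f φ lam x ≤ penaltyFun f φ lam y} =
      {x | x ∈ M ∩ A ∧ ∀ y ∈ M ∩ A, f x ≤ f y}

theorem penaltyFun_mono {X : Type*} {f : X → EReal} {φ : X → ℝ} {x : X} (hφ : 0 ≤ φ x)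
    {a b : ℝ} (hab : a ≤ b) : penaltyFun f φ a x ≤ penaltyFun f φ b x :=
  add_le_add_right (EReal.coe_le_coe_iff.2 (mul_le_mul_of_nonneg_right hab hφ)) _

theorem penaltyFun_of_eq_zero {X : Type*} {f : X → EReal} {φ : X → ℝ} {x : X} (hφ : φ x = 0)
    (lam : ℝ) : penaltyFun f φ lam x = f x := by
  simp [penaltyFun, hφ]

theorem lt_penaltyFun_of_le {X : Type*} {f : X → EReal} {φ : X → ℝ} {x : X} (hφ : 0 < φ x)
    {a b m : ℝ} (hab : a < b) (h : (m : EReal) ≤ penaltyFun f φ a x) :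
    (m : EReal) < penaltyFun f φ b x := by
  have hmul : a * φ x < b * φ x := mul_lt_mul_of_pos_right hab hφ
  unfold penaltyFun at *
  induction hfx : f x with
  | bot => simp [hfx] at h
  | top => exact (EReal.top_add_coe (b * φ x)).symm ▸ EReal.coe_lt_top m
  | coe r =>
    rw [hfx] at h
    norm_cast at *
    linarith

/-- Away from the zero set of `φ`, a large enough penalty parameter lifts the penalty function
above any given real level near the point. -/
theorem exists_eventually_le_penaltyFun_of_pos {X : Type*} [TopologicalSpace X]
    {f : X → EReal} {φ : X → ℝ} {A : Set X} {x : X} (hf : LowerSemicontinuousWithinAt f A x)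
    (hφ : LowerSemicontinuousWithinAt φ A x) (hbot : f x ≠ ⊥) (hpos : 0 < φ x) (m : ℝ) :
    ∃ lam : ℝ, 0 ≤ lam ∧ ∀ᶠ y in 𝓝[A] x, (m : EReal) ≤ penaltyFun f φ lam y := by
  obtain ⟨c, -, hc⟩ := EReal.lt_iff_exists_real_btwn.1 (bot_lt_iff_ne_bot.2 hbot)
  have hhalf : 0 < φ x / 2 := half_pos hpos
  refine ⟨|m - c| / (φ x / 2), by positivity, ?_⟩
  filter_upwards [hf _ hc, hφ _ (half_lt_self hpos)] with y hfy hφy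
  have hlam : |m - c| ≤ |m - c| / (φ x / 2) * φ y := by
    rw [div_mul_eq_mul_div, le_div_iff₀ hhalf]
    exact mul_le_mul_of_nonneg_left hφy.le (abs_nonneg _)
  calc (m : EReal) ≤ ((c + |m - c| / (φ x / 2) * φ y : ℝ) : EReal) :=
        EReal.coe_le_coe_iff.2 (by linarith [le_abs_self (m - c)])
    _ = (c : EReal) + ((|m - c| / (φ x / 2) * φ y : ℝ) : EReal) := EReal.coe_add _ _
    _ ≤ penaltyFun f φ (|m - c| / (φ x / 2)) y := add_le_add_left hfy.le _

theorem IsCompact.exists_forall_le_penaltyFun {X : Type*} [TopologicalSpace X]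
    {f : X → EReal} {φ : X → ℝ} {A : Set X} (hA : IsCompact A) (hφ : ∀ x, 0 ≤ φ x) {m : EReal}
    (h : ∀ x ∈ A, ∃ lam : ℝ, 0 ≤ lam ∧ ∀ᶠ y in 𝓝[A] x, m ≤ penaltyFun f φ lam y) :
    ∃ lam : ℝ, 0 ≤ lam ∧ ∀ y ∈ A, m ≤ penaltyFun f φ lam y := by
  refine hA.induction_on (p := fun s => ∃ lam : ℝ, 0 ≤ lam ∧ ∀ y ∈ s, m ≤ penaltyFun f φ lam y)
    ⟨0, le_rfl, by simp⟩ ?_ ?_ ?_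
  · rintro s t hst ⟨lam, hlam, ht⟩
    exact ⟨lam, hlam, fun y hy => ht y (hst hy)⟩
  · rintro s t ⟨a, ha, hs⟩ ⟨b, -, ht⟩
    refine ⟨max a b, ha.trans (le_max_left _ _), ?_⟩
    rintro y (hy | hy)
    · exact (hs y hy).trans (penaltyFun_mono (hφ y) (le_max_left _ _))
    · exact (ht y hy).trans (penaltyFun_mono (hφ y) (le_max_right _ _))
  · intro x hx
    obtain ⟨lam, hlam, hev⟩ := h x hx
    exact ⟨_, hev, lam, hlam, fun y hy => hy⟩

/-- Theorem: for compact `A` and lower semicontinuous `f`, `φ` on `A`, the penalty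
function `F_λ` is globally exact iff it is exact at every globally optimal solution of
the problem `(𝒫)`. -/
theorem globallyExact_iff_exact_at_global_solutions_of_compact {X : Type*}
    [TopologicalSpace X]
    (f : X → EReal) (φ : X → ℝ) (A M : Set X)
    (hAne : A.Nonempty) (hMne : M.Nonempty)
    (hfbot : ∀ x, f x ≠ ⊥) (hφnn : ∀ x, 0 ≤ φ x) (hMdef : M = {x | φ x = 0})
    (hattain : ∃ z ∈ M ∩ A, (∀ y ∈ M ∩ A, f z ≤ f y) ∧ f z ≠ ⊤)
    (hcomp : IsCompact A)
    (hflsc : LowerSemicontinuousOn f A) (hφlsc : LowerSemicontinuousOn (fun x => (φ x : ℝ)) A) :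
    GloballyExact f φ A M ↔
      ∀ xs : X, xs ∈ M ∩ A → (∀ y ∈ M ∩ A, f xs ≤ f y) → f xs ≠ ⊤ →
        ExactPenaltyAt f φ A xs := by
  subst hMdef
  constructor
  · rintro ⟨lam0, h0, hexact⟩ xs hxs hmin -
    refine ⟨lam0 + 1, by linarith, ?_⟩
    have hmem := (hexact (lam0 + 1) (by linarith)).ge ⟨hxs, hmin⟩
    exact eventually_nhdsWithin_of_forall hmem.2
  · intro hloc
    obtain ⟨z, hz, hzmin, hztop⟩ := hattain
    obtain ⟨m, hm⟩ : ∃ m : ℝ, (m : EReal) = f z := ⟨_, EReal.coe_toReal hztop (hfbot z)⟩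
    obtain ⟨lam0, h0, hle⟩ : ∃ lam : ℝ, 0 ≤ lam ∧ ∀ y ∈ A, (m : EReal) ≤ penaltyFun f φ lam y := by
      refine hcomp.exists_forall_le_penaltyFun hφnn fun x hx => ?_
      rcases (hφnn x).eq_or_lt with hzero | hpos
      · have hxM : x ∈ {x | φ x = 0} ∩ A := ⟨hzero.symm, hx⟩
        rcases (hzmin x hxM).eq_or_lt with heq | hlt
        · obtain ⟨lam, hlam, hmin⟩ := hloc x hxM (heq ▸ hzmin) (heq ▸ hztop)
          refine ⟨lam, hlam, hmin.mono fun y hy => ?_⟩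
          rwa [penaltyFun_of_eq_zero hzero.symm, ← heq, ← hm] at hy
        · refine ⟨0, le_rfl, (hflsc x hx _ (hm ▸ hlt)).mono fun y hy => ?_⟩
          simpa [penaltyFun] using hy.le
      · exact exists_eventually_le_penaltyFun_of_pos (hflsc x hx) (hφlsc x hx) (hfbot x) hpos m
    refine ⟨lam0, h0, fun lam hlam => Subset.antisymm ?_ ?_⟩
    · rintro x ⟨hxA, hxmin⟩
      have hxm : penaltyFun f φ lam x ≤ m := by
        rw [hm, ← penaltyFun_of_eq_zero (f := f) hz.1 lam]
        exact hxmin z hz.2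
      have hx0 : φ x = 0 := by
        by_contra hne
        exact (lt_penaltyFun_of_le ((hφnn x).lt_of_ne' hne) hlam (hle x hxA)).not_ge hxm
      rw [penaltyFun_of_eq_zero hx0, hm] at hxm
      exact ⟨⟨hx0, hxA⟩, fun y hy => hxm.trans (hzmin y hy)⟩
    · rintro x ⟨hx, hxmin⟩
      refine ⟨hx.2, fun y hy => ?_⟩
      rw [penaltyFun_of_eq_zero hx.1]
      exact (hxmin z hz).trans
        (hm ▸ (hle y hy).trans (penaltyFun_mono (hφnn y) hlam.le))
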